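/- The casino DPN is not data-aware sound: for the DPN N defined in the context (with M_I = one token on i, α_I(age) = 0, α_I(hasPass) = 0, and M_F = one token on o), the state (M, α) with M = one token on p2 and α(age) = 12, α(hasPass) = 0 belongs to Reach_N, and there is no valuation α' with (M, α) →* (M_F, α'); hence condition C1 of data-aware soundness fails and N is not data-aware sound. -/

import Mathlib

/-- Comparison operators appearing in atomic arithmetic constraints. -/
inductive CmpOp : Type
  | lt | eq | gt

def CmpOp.eval : CmpOp → ℝ → ℝ → Prop
  | .lt, a, b => a < b
  | .eq, a, b => a = b
  | .gt, a, b => a > b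

/-- Arithmetic constraints over a variable set `X`:
`φ ::= ⊤ | x ⊙ y | x ⊙ c | ¬φ | φ₁ ∧ φ₂`. -/
inductive AC (X : Type) : Type
  | top : AC X
  | atomVV : X → CmpOp → X → AC X
  | atomVC : X → CmpOp → ℝ → AC X
  | neg : AC X → AC X
  | and : AC X → AC X → AC X

/-- Satisfaction of an arithmetic constraint by a total assignment. -/
def AC.sat {X : Type} : AC X → (X → ℝ) → Prop
  | .top, _ => True
  | .atomVV x op y, θ => op.eval (θ x) (θ y)
  | .atomVC x op c, θ => op.eval (θ x) c
  | .neg φ, θ => ¬ φ.sat θ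
  | .and φ ψ, θ => φ.sat θ ∧ ψ.sat θ

/-- Variables occurring in an arithmetic constraint. -/
def AC.vars {X : Type} : AC X → Set X
  | .top => ∅
  | .atomVV x _ y => {x, y}
  | .atomVC x _ _ => {x}
  | .neg φ => φ.vars
  | .and φ ψ => φ.vars ∪ ψ.vars

/-- `⟦φ⟧`: the set of total assignments satisfying `φ`. -/
def AC.sem {X : Type} (φ : AC X) : Set (X → ℝ) := {θ | φ.sat θ}

/-- A Data Petri Net over places `P`, transitions `T` and variables `V`.
Guards are arithmetic constraints over `V^r ∪ V^w`, encoded as `V ⊕ V`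
(`Sum.inl v` is `v^r`, `Sum.inr v` is `v^w`).  `pre p t = F(p,t)`,
`post t p = F(t,p)`. -/
structure DPN (P T V : Type) : Type where
  pre : P → T → ℕ
  post : T → P → ℕ
  guard : T → AC (V ⊕ V)

namespace DPN

variable {P T V : Type}

/-- `write t`: variables `v` such that `v^w` occurs in `guard t`. -/
def write (N : DPN P T V) (t : T) : Set V := {v | Sum.inr v ∈ (N.guard t).vars}

/-- Transition firing `(M, α) →t (M', α')`. -/
def fires (N : DPN P T V) (M : P → ℕ) (α : V → ℝ) (t : T) (M' : P → ℕ) (α' : V → ℝ) : Prop :=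
  (∀ p, N.pre p t ≤ M p) ∧
  (∀ p, M' p = M p - N.pre p t + N.post t p) ∧
  (N.guard t).sat (Sum.elim α α') ∧
  (∀ v, v ∉ N.write t → α' v = α v)

/-- The reachability set of `N` from initial state `(MI, αI)`. -/
inductive Reach (N : DPN P T V) (MI : P → ℕ) (αI : V → ℝ) : (P → ℕ) → (V → ℝ) → Prop
  | init : Reach N MI αI MI αI
  | step {M α t M' α'} : Reach N MI αI M α → N.fires M α t M' α' → Reach N MI αI M' α'

/-- Firing of a trace `σ`: `(M, α) →σ (M', α')`. -/
def firesSeq (N : DPN P T V) : (P → ℕ) → (V → ℝ) → List T → (P → ℕ) → (V → ℝ) → Prop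
  | M, α, [], M', α' => M = M' ∧ α = α'
  | M, α, t :: σ, M'', α'' => ∃ M' α', N.fires M α t M' α' ∧ N.firesSeq M' α' σ M'' α''

/-- Data-aware soundness of `N` w.r.t. initial state `(MI, αI)` and final marking `MF`. -/
def Sound (N : DPN P T V) (MI MF : P → ℕ) (αI : V → ℝ) : Prop :=
  (∀ M α, N.Reach MI αI M α → ∃ σ α', N.firesSeq M α σ MF α') ∧
  (∀ M α, N.Reach MI αI M α → (∀ p, MF p ≤ M p) → M = MF) ∧
  (∀ t : T, ∃ M₁ α₁ M₂ α₂, N.Reach MI αI M₁ α₁ ∧ N.fires M₁ α₁ t M₂ α₂)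

end DPN

/-- `N'` is a guard restriction of `N`: same places, transitions, flow and variables,
with `⟦guard'(t)⟧ ⊆ ⟦guard(t)⟧` and `write'(t) = write(t)` for every `t`. -/
def GuardRestriction {P T V : Type} (N' N : DPN P T V) : Prop :=
  N'.pre = N.pre ∧ N'.post = N.post ∧
  ∀ t, (N'.guard t).sem ⊆ (N.guard t).sem ∧ N'.write t = N.write t

/-- Places of the casino DPN. -/
inductive CasP : Type
  | i | p1 | p2 | p3 | o
deriving DecidableEq

/-- Transitions of the casino DPN: Enter Casino, Quit, Register, Receive Pass,
Enter Gambling Room, Gamble. -/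
inductive CasT : Type
  | EC | Q | R | RP | EGR | G
deriving DecidableEq

/-- Variables of the casino DPN. -/
inductive CasV : Type
  | age | hasPass
deriving DecidableEq

/-- `F(p,t)` of the casino DPN. -/
def casPre : CasP → CasT → ℕ
  | .i, .EC => 1
  | .p1, .Q => 1
  | .p1, .R => 1
  | .p2, .RP => 1
  | .p1, .EGR => 1
  | .p3, .G => 1
  | _, _ => 0

/-- `F(t,p)` of the casino DPN. -/
def casPost : CasT → CasP → ℕ
  | .EC, .p1 => 1
  | .Q, .o => 1
  | .R, .p2 => 1
  | .RP, .p1 => 1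
  | .EGR, .p3 => 1
  | .G, .p1 => 1
  | _, _ => 0

/-- Guards of the casino DPN (`Sum.inl v = v^r`, `Sum.inr v = v^w`;
`a ∨ b` is the derived `¬(¬a ∧ ¬b)`). -/
def casGuard : CasT → AC (CasV ⊕ CasV)
  | .EC => .and (.atomVC (Sum.inr CasV.age) .gt 0)
      (.neg (.and (.neg (.atomVC (Sum.inr CasV.hasPass) .eq 0))
                  (.neg (.atomVC (Sum.inr CasV.hasPass) .eq 1))))
  | .Q => .top
  | .R => .atomVC (Sum.inl CasV.hasPass) .eq 0
  | .RP => .and (.atomVC (Sum.inl CasV.age) .gt 18)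
                (.atomVC (Sum.inr CasV.hasPass) .eq 1)
  | .EGR => .atomVC (Sum.inl CasV.hasPass) .eq 1
  | .G => .top

/-- The casino DPN. -/
def casino : DPN CasP CasT CasV := ⟨casPre, casPost, casGuard⟩

def casMI : CasP → ℕ := fun p => if p = CasP.i then 1 else 0
def casMF : CasP → ℕ := fun p => if p = CasP.o then 1 else 0
def casαI : CasV → ℝ := fun _ => 0
def casM : CasP → ℕ := fun p => if p = CasP.p2 then 1 else 0
def casα : CasV → ℝ := fun v => match v with | .age => 12 | .hasPass => 0

/-- The state with age `12` and a token on `p2` is reached by entering the casino and registering. -/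
theorem casino_reach_casM : casino.Reach casMI casαI casM casα := by
  have hEC : casino.fires casMI casαI .EC (fun p => if p = CasP.p1 then 1 else 0) casα := by
    refine ⟨fun p => by cases p <;> decide, fun p => by cases p <;> decide, ?_, ?_⟩
    · simp [casino, casGuard, AC.sat, CmpOp.eval, casα]
    · intro v hv
      cases v <;> simp [DPN.write, casino, casGuard, AC.vars] at hv
  have hR : casino.fires (fun p => if p = CasP.p1 then 1 else 0) casα .R casM casα := by
    refine ⟨fun p => by cases p <;> decide, fun p => by cases p <;> decide, ?_, fun _ _ => rfl⟩
    simp [casino, casGuard, AC.sat, CmpOp.eval, casα]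
  exact .step (.step .init hEC) hR

/-- No transition is enabled in the state with age `12` and a token on `p2`. -/
theorem casino_not_fires_casM (t : CasT) (M : CasP → ℕ) (α : CasV → ℝ) :
    ¬ casino.fires casM casα t M α := by
  rintro ⟨hpre, -, hguard, -⟩
  cases t with
  | EC => exact absurd (hpre .i) (by decide)
  | Q => exact absurd (hpre .p1) (by decide)
  | R => exact absurd (hpre .p1) (by decide)
  | EGR => exact absurd (hpre .p1) (by decide)
  | G => exact absurd (hpre .p3) (by decide)
  | RP =>
    have hage : (12 : ℝ) > 18 := hguard.1
    norm_num at hage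

theorem casino_not_firesSeq_casMF :
    ¬ ∃ (σ : List CasT) (α' : CasV → ℝ), casino.firesSeq casM casα σ casMF α' := by
  rintro ⟨_ | ⟨t, σ⟩, α', h⟩
  · exact absurd (congrFun h.1 .p2) (by decide)
  · obtain ⟨M, α, hfire, -⟩ := h
    exact casino_not_fires_casM t M α hfire

/-- the casino DPN is not data-aware sound: the state with one token
on `p2`, `age = 12`, `hasPass = 0` is reachable, but no final state `(M_F, α')` is
reachable from it; hence condition C1 fails and the net is not data-aware sound. -/
theorem stmt14 :
    casino.Reach casMI casαI casM casα ∧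
    (¬ ∃ (σ : List CasT) (α' : CasV → ℝ), casino.firesSeq casM casα σ casMF α') ∧
    ¬ casino.Sound casMI casMF casαI :=
  ⟨casino_reach_casM, casino_not_firesSeq_casMF,
    fun h => casino_not_firesSeq_casMF (h.1 _ _ casino_reach_casM)⟩
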